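/- Define $P_n, Q_n, R_n$ by the common recursion $X_n = X_{n-1} + (q+q^n)X_{n-2} - qX_{n-3}$ with $P_0=0, P_1=1, P_2=1$; $Q_0=1, Q_1=1, Q_2=1+q+q^2$; $R_0=1, R_1=1+q, R_2=1+q+q^2$. Then for all integers $m \ge 1$, $\det\begin{pmatrix} P_{m-1} & Q_{m-1} & R_{m-1} \\ P_m & Q_m & R_m \\ P_{m+1} & Q_{m+1} & R_{m+1} \end{pmatrix} = (-1)^{m-1} q^m$. -/

import Mathlib

theorem stmt17 {R : Type*} [CommRing R] (q : R)
    (P Q S : ℕ → R)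
    (hP0 : P 0 = 0) (hP1 : P 1 = 1) (hP2 : P 2 = 1)
    (hQ0 : Q 0 = 1) (hQ1 : Q 1 = 1) (hQ2 : Q 2 = 1 + q + q ^ 2)
    (hS0 : S 0 = 1) (hS1 : S 1 = 1 + q) (hS2 : S 2 = 1 + q + q ^ 2)
    (hP : ∀ n : ℕ, P (n + 3) = P (n + 2) + (q + q ^ (n + 3)) * P (n + 1) - q * P n)
    (hQ : ∀ n : ℕ, Q (n + 3) = Q (n + 2) + (q + q ^ (n + 3)) * Q (n + 1) - q * Q n)
    (hS : ∀ n : ℕ, S (n + 3) = S (n + 2) + (q + q ^ (n + 3)) * S (n + 1) - q * S n)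
    (m : ℕ) (hm : 1 ≤ m) :
    Matrix.det !![P (m - 1), Q (m - 1), S (m - 1);
                  P m, Q m, S m;
                  P (m + 1), Q (m + 1), S (m + 1)] = (-1) ^ (m - 1) * q ^ m := by
  obtain ⟨n, rfl⟩ := Nat.exists_eq_add_of_le' hm
  clear hm
  rw [Nat.add_sub_cancel]
  induction n with
  | zero =>
    simp [Matrix.det_fin_three, hP0, hP1, hP2, hQ0, hQ1, hQ2, hS0, hS1, hS2]
    ring
  | succ n ih =>
    simp only [Matrix.det_fin_three, Matrix.of_apply, Matrix.cons_val, Nat.add_assoc,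
      Nat.reduceAdd] at ih ⊢
    rw [hP, hQ, hS]
    linear_combination (-q) * ih
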